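/- Two-channel LCT filter bank in modulation form: let h₀, h₁, g₀, g₁, x : ℤ → ℂ be finitely supported with sampling period T, and let x̂ = Σ_{i=0}^{1} gᵢ ∗ up2( down2( hᵢ ∗ x ) ), where down2(u)(n) = u(2n) and up2(y)(2n) = y(n), up2(y)(m) = 0 for odd m. Define the vectors X_m(ω) = (X(ω), X(ω+π))ᵀ, X̂_m(ω) = (X̂(ω), X̂(ω+π))ᵀ, the matrices G_m(ω) = [[G₀(ω), G₁(ω)], [G₀(ω+π), G₁(ω+π)]], H_m(ω) = [[H₀(ω), H₀(ω+π)], [H₁(ω), H₁(ω+π)]], and A(ω) = diag( exp(−i·d·b·ω²/T²), exp(−i·d·b·(ω+π)²/T²) ), where all capital letters denote DTLCTs with sampling period T. Then for all ω ∈ ℝ, X̂_m(ω) = (1/2)·G_m(ω)·H_m(ω)·A(ω)·X_m(ω). -/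

import Mathlib

open Real Complex Matrix

/-- Discrete-time linear canonical transform (constant prefactor omitted). -/
noncomputable def dtlct (a b d T : ℝ) (x : ℤ → ℂ) (ω : ℝ) : ℂ :=
  ∑ᶠ n : ℤ, x n * Complex.exp ((Complex.I / 2) *
    (((a / b) * (n : ℝ) ^ 2 * T ^ 2 - 2 * (n : ℝ) * ω + (d * b / T ^ 2) * ω ^ 2 : ℝ) : ℂ))

/-- LCT convolution at sampling period `T`. -/
noncomputable def lctConv (a b T : ℝ) (h x : ℤ → ℂ) (n : ℤ) : ℂ :=
  ∑ᶠ k : ℤ, h k * x (n - k) *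
    Complex.exp (-Complex.I * (((a * T ^ 2 / b) * (k : ℝ) * ((n : ℝ) - (k : ℝ)) : ℝ) : ℂ))

/-- Downsampling by 2. -/
def down2 (u : ℤ → ℂ) (n : ℤ) : ℂ := u (2 * n)

/-- Upsampling by 2. -/
noncomputable def up2 (y : ℤ → ℂ) (m : ℤ) : ℂ := if 2 ∣ m then y (m / 2) else 0

theorem finite_support_lctConv (a b T : ℝ) {h x : ℤ → ℂ} (hh : (Function.support h).Finite)
    (hx : (Function.support x).Finite) : (Function.support (lctConv a b T h x)).Finite := by
  refine (hh.add hx).subset fun n hn => ?_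
  obtain ⟨k, hk⟩ : ∃ k, h k * x (n - k) * Complex.exp (-Complex.I *
      (((a * T ^ 2 / b) * (k : ℝ) * ((n : ℝ) - (k : ℝ)) : ℝ) : ℂ)) ≠ 0 := by
    by_contra! h0
    exact hn (finsum_eq_zero_of_forall_eq_zero h0)
  have hk' := left_ne_zero_of_mul hk
  exact ⟨k, left_ne_zero_of_mul hk', n - k, right_ne_zero_of_mul hk', add_sub_cancel k n⟩

theorem finite_support_up2_down2 {u : ℤ → ℂ} (hu : (Function.support u).Finite) :
    (Function.support (up2 (down2 u))).Finite := by
  refine hu.subset fun n hn => ?_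
  by_cases h : (2 : ℤ) ∣ n
  · simpa [up2, down2, h, Int.mul_ediv_cancel' h] using hn
  · simp [up2, h] at hn

theorem dtlct_add (a b d T : ℝ) {x y : ℤ → ℂ} (hx : (Function.support x).Finite)
    (hy : (Function.support y).Finite) (ω : ℝ) :
    dtlct a b d T (fun n => x n + y n) ω = dtlct a b d T x ω + dtlct a b d T y ω := by
  simp only [dtlct, add_mul]
  exact finsum_add_distrib (hx.subset fun _ h => left_ne_zero_of_mul h)
    (hy.subset fun _ h => left_ne_zero_of_mul h)

/-- The LCT convolution theorem. -/
theorem dtlct_lctConv (a b d T : ℝ) {h x : ℤ → ℂ} (hh : (Function.support h).Finite)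
    (hx : (Function.support x).Finite) (ω : ℝ) :
    dtlct a b d T (lctConv a b T h x) ω =
      dtlct a b d T h ω * dtlct a b d T x ω *
        Complex.exp (-(Complex.I / 2) * ((d * b / T ^ 2 * ω ^ 2 : ℝ) : ℂ)) := by
  have hconv (n : ℤ) : lctConv a b T h x n = ∑ k ∈ hh.toFinset, h k * x (n - k) *
      Complex.exp (-Complex.I *
        (((a * T ^ 2 / b) * (k : ℝ) * ((n : ℝ) - (k : ℝ)) : ℝ) : ℂ)) :=
    finsum_eq_sum_of_support_subset _ fun k hk => by
      simpa using left_ne_zero_of_mul (left_ne_zero_of_mul hk)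
  have hsum : dtlct a b d T h ω = ∑ k ∈ hh.toFinset, h k * Complex.exp ((Complex.I / 2) *
      (((a / b) * (k : ℝ) ^ 2 * T ^ 2 - 2 * (k : ℝ) * ω + (d * b / T ^ 2) * ω ^ 2 : ℝ) : ℂ)) :=
    finsum_eq_sum_of_support_subset _ fun k hk => by simpa using left_ne_zero_of_mul hk
  rw [hsum, dtlct]
  simp only [hconv, Finset.sum_mul]
  rw [finsum_sum_comm]
  · refine Finset.sum_congr rfl fun k _ => ?_
    rw [dtlct, mul_finsum, finsum_mul, ← finsum_comp_equiv (Equiv.addRight k)]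
    refine finsum_congr fun n => ?_
    simp only [Equiv.coe_addRight, add_sub_cancel_right]
    have hexp (p q r s t : ℂ) (u v : ℂ) (hpq : p + q = r + s + t) :
        u * v * Complex.exp p * Complex.exp q =
          u * Complex.exp r * (v * Complex.exp s) * Complex.exp t := by
      rw [mul_assoc, ← Complex.exp_add, hpq, Complex.exp_add, Complex.exp_add]
      ring
    apply hexp
    push_cast
    ring
  · intro k _
    refine (hx.preimage (sub_left_injective (b := k)).injOn).subset fun n hn => ?_
    exact right_ne_zero_of_mul (left_ne_zero_of_mul (left_ne_zero_of_mul hn))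

theorem exp_dtlct_kernel_add_pi (a b d T : ℝ) (n : ℤ) (ω : ℝ) :
    Complex.exp ((Complex.I / 2) * (((a / b) * (n : ℝ) ^ 2 * T ^ 2 - 2 * (n : ℝ) * (ω + π) +
        (d * b / T ^ 2) * (ω + π) ^ 2 : ℝ) : ℂ)) =
      (-1) ^ n * Complex.exp ((Complex.I / 2) * (((a / b) * (n : ℝ) ^ 2 * T ^ 2 -
        2 * (n : ℝ) * ω + (d * b / T ^ 2) * ω ^ 2 : ℝ) : ℂ)) *
      Complex.exp ((Complex.I / 2) *
        ((d * b / T ^ 2 * (ω + π) ^ 2 - d * b / T ^ 2 * ω ^ 2 : ℝ) : ℂ)) := by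
  have hsign : ((-1 : ℂ)) ^ n = Complex.exp (-(n * (π * Complex.I))) := by
    rw [Complex.exp_neg, Complex.exp_int_mul, Complex.exp_pi_mul_I, ← _root_.inv_zpow]
    norm_num
  rw [hsign, ← Complex.exp_add, ← Complex.exp_add]
  congr 1
  push_cast
  ring

theorem dtlct_up2_add_pi (a b d T : ℝ) (y : ℤ → ℂ) (ω : ℝ) :
    dtlct a b d T (up2 y) (ω + π) = dtlct a b d T (up2 y) ω * Complex.exp ((Complex.I / 2) *
      ((d * b / T ^ 2 * (ω + π) ^ 2 - d * b / T ^ 2 * ω ^ 2 : ℝ) : ℂ)) := by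
  rw [dtlct, dtlct, finsum_mul]
  refine finsum_congr fun n => ?_
  rw [exp_dtlct_kernel_add_pi]
  by_cases h : (2 : ℤ) ∣ n
  · rw [(even_iff_two_dvd.mpr h).neg_one_zpow]
    ring
  · simp [up2, h]

theorem dtlct_up2_down2 (a b d T : ℝ) {u : ℤ → ℂ} (hu : (Function.support u).Finite) (ω : ℝ) :
    dtlct a b d T (up2 (down2 u)) ω = (1 / 2) * (dtlct a b d T u ω +
      dtlct a b d T u (ω + π) * Complex.exp (-(Complex.I / 2) *
        ((d * b / T ^ 2 * (ω + π) ^ 2 - d * b / T ^ 2 * ω ^ 2 : ℝ) : ℂ))) := by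
  have hfin (f : ℤ → ℂ) : (Function.support fun n => u n * f n).Finite :=
    hu.subset fun _ hn => left_ne_zero_of_mul hn
  simp only [dtlct]
  rw [finsum_mul, ← finsum_add_distrib (hfin _)
    ((hfin _).subset fun _ hn => left_ne_zero_of_mul hn), mul_finsum]
  refine finsum_congr fun n => ?_
  beta_reduce
  rw [exp_dtlct_kernel_add_pi, neg_mul, Complex.exp_neg]
  have hne := Complex.exp_ne_zero ((Complex.I / 2) *
    ((d * b / T ^ 2 * (ω + π) ^ 2 - d * b / T ^ 2 * ω ^ 2 : ℝ) : ℂ))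
  rw [mul_assoc (u n), mul_inv_cancel_right₀ hne]
  by_cases h : (2 : ℤ) ∣ n
  · rw [(even_iff_two_dvd.mpr h).neg_one_zpow]
    simp only [up2, down2, h, if_true, Int.mul_ediv_cancel' h]
    ring
  · rw [(Int.not_even_iff_odd.mp (even_iff_two_dvd.not.mpr h)).neg_one_zpow]
    simp only [up2, h, if_false]
    ring

/-- The analysis half of a channel: filtering by `h`, then down- and upsampling. -/
theorem dtlct_up2_down2_lctConv (a b d T : ℝ) {h x : ℤ → ℂ} (hh : (Function.support h).Finite)
    (hx : (Function.support x).Finite) (ω : ℝ) :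
    dtlct a b d T (up2 (down2 (lctConv a b T h x))) ω *
        Complex.exp (-(Complex.I / 2) * ((d * b / T ^ 2 * ω ^ 2 : ℝ) : ℂ)) =
      (1 / 2) *
        (dtlct a b d T h ω * Complex.exp (-Complex.I * ((d * b * ω ^ 2 / T ^ 2 : ℝ) : ℂ)) *
            dtlct a b d T x ω +
          dtlct a b d T h (ω + π) *
            Complex.exp (-Complex.I * ((d * b * (ω + π) ^ 2 / T ^ 2 : ℝ) : ℂ)) *
            dtlct a b d T x (ω + π)) := by
  rw [dtlct_up2_down2 a b d T (finite_support_lctConv a b T hh hx),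
    dtlct_lctConv a b d T hh hx, dtlct_lctConv a b d T hh hx]
  have h₁ : Complex.exp (-Complex.I * ((d * b * ω ^ 2 / T ^ 2 : ℝ) : ℂ)) =
      Complex.exp (-(Complex.I / 2) * ((d * b / T ^ 2 * ω ^ 2 : ℝ) : ℂ)) *
        Complex.exp (-(Complex.I / 2) * ((d * b / T ^ 2 * ω ^ 2 : ℝ) : ℂ)) := by
    rw [← Complex.exp_add]
    congr 1
    push_cast
    ring
  have h₂ : Complex.exp (-Complex.I * ((d * b * (ω + π) ^ 2 / T ^ 2 : ℝ) : ℂ)) =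
      Complex.exp (-(Complex.I / 2) * ((d * b / T ^ 2 * (ω + π) ^ 2 : ℝ) : ℂ)) *
        Complex.exp (-(Complex.I / 2) *
          ((d * b / T ^ 2 * (ω + π) ^ 2 - d * b / T ^ 2 * ω ^ 2 : ℝ) : ℂ)) *
        Complex.exp (-(Complex.I / 2) * ((d * b / T ^ 2 * ω ^ 2 : ℝ) : ℂ)) := by
    rw [← Complex.exp_add, ← Complex.exp_add]
    congr 1
    push_cast
    ring
  rw [h₁, h₂]
  ring

/-- One channel of the filter bank: analysis filter `h`, down- and upsampling, synthesis
filter `g`. -/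
theorem dtlct_channel (a b d T : ℝ) {g h x : ℤ → ℂ} (hg : (Function.support g).Finite)
    (hh : (Function.support h).Finite) (hx : (Function.support x).Finite) (ω : ℝ) :
    dtlct a b d T (lctConv a b T g (up2 (down2 (lctConv a b T h x)))) ω =
      (1 / 2) * dtlct a b d T g ω *
        (dtlct a b d T h ω * Complex.exp (-Complex.I * ((d * b * ω ^ 2 / T ^ 2 : ℝ) : ℂ)) *
            dtlct a b d T x ω +
          dtlct a b d T h (ω + π) *
            Complex.exp (-Complex.I * ((d * b * (ω + π) ^ 2 / T ^ 2 : ℝ) : ℂ)) *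
            dtlct a b d T x (ω + π)) := by
  rw [dtlct_lctConv a b d T hg (finite_support_up2_down2 (finite_support_lctConv a b T hh hx)),
    mul_assoc, dtlct_up2_down2_lctConv a b d T hh hx]
  ring

/-- One channel of the filter bank, evaluated at the modulated frequency `ω + π`. -/
theorem dtlct_channel_add_pi (a b d T : ℝ) {g h x : ℤ → ℂ} (hg : (Function.support g).Finite)
    (hh : (Function.support h).Finite) (hx : (Function.support x).Finite) (ω : ℝ) :
    dtlct a b d T (lctConv a b T g (up2 (down2 (lctConv a b T h x)))) (ω + π) =
      (1 / 2) * dtlct a b d T g (ω + π) *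
        (dtlct a b d T h ω * Complex.exp (-Complex.I * ((d * b * ω ^ 2 / T ^ 2 : ℝ) : ℂ)) *
            dtlct a b d T x ω +
          dtlct a b d T h (ω + π) *
            Complex.exp (-Complex.I * ((d * b * (ω + π) ^ 2 / T ^ 2 : ℝ) : ℂ)) *
            dtlct a b d T x (ω + π)) := by
  rw [dtlct_lctConv a b d T hg (finite_support_up2_down2 (finite_support_lctConv a b T hh hx)),
    dtlct_up2_add_pi, mul_assoc,
    mul_assoc (dtlct a b d T (up2 _) ω), ← Complex.exp_add]
  have hexp : (Complex.I / 2) *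
        ((d * b / T ^ 2 * (ω + π) ^ 2 - d * b / T ^ 2 * ω ^ 2 : ℝ) : ℂ) +
      -(Complex.I / 2) * ((d * b / T ^ 2 * (ω + π) ^ 2 : ℝ) : ℂ) =
      -(Complex.I / 2) * ((d * b / T ^ 2 * ω ^ 2 : ℝ) : ℂ) := by
    push_cast
    ring
  rw [hexp, dtlct_up2_down2_lctConv a b d T hh hx]
  ring

/-- Two-channel LCT filter bank in modulation form:
`X̂_m(ω) = (1/2)·G_m(ω)·H_m(ω)·A(ω)·X_m(ω)`. -/
theorem dtlct_filter_bank_modulation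
    (a b c d T : ℝ) (hb : 0 < b) (habcd : a * d - b * c = 1) (hT : 0 < T)
    (h₀ h₁ g₀ g₁ x : ℤ → ℂ)
    (hh₀ : (Function.support h₀).Finite) (hh₁ : (Function.support h₁).Finite)
    (hg₀ : (Function.support g₀).Finite) (hg₁ : (Function.support g₁).Finite)
    (hx : (Function.support x).Finite)
    (xhat : ℤ → ℂ)
    (hxhat : ∀ n : ℤ,
      xhat n = lctConv a b T g₀ (up2 (down2 (lctConv a b T h₀ x))) n +
               lctConv a b T g₁ (up2 (down2 (lctConv a b T h₁ x))) n) :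
    ∀ ω : ℝ,
      ![dtlct a b d T xhat ω, dtlct a b d T xhat (ω + π)] =
      (1 / 2 : ℂ) •
        ((!![dtlct a b d T g₀ ω, dtlct a b d T g₁ ω;
             dtlct a b d T g₀ (ω + π), dtlct a b d T g₁ (ω + π)] *
          !![dtlct a b d T h₀ ω, dtlct a b d T h₀ (ω + π);
             dtlct a b d T h₁ ω, dtlct a b d T h₁ (ω + π)] *
          !![Complex.exp (-Complex.I * ((d * b * ω ^ 2 / T ^ 2 : ℝ) : ℂ)), 0;
             0, Complex.exp (-Complex.I * ((d * b * (ω + π) ^ 2 / T ^ 2 : ℝ) : ℂ))]).mulVec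
          ![dtlct a b d T x ω, dtlct a b d T x (ω + π)]) := by
  intro ω
  obtain rfl : xhat = fun n => _ := funext hxhat
  have hfin {g h : ℤ → ℂ} (hg : (Function.support g).Finite)
      (hh : (Function.support h).Finite) :=
    finite_support_lctConv a b T hg
      (finite_support_up2_down2 (finite_support_lctConv a b T hh hx))
  rw [dtlct_add a b d T (hfin hg₀ hh₀) (hfin hg₁ hh₁),
    dtlct_add a b d T (hfin hg₀ hh₀) (hfin hg₁ hh₁),
    dtlct_channel a b d T hg₀ hh₀ hx, dtlct_channel a b d T hg₁ hh₁ hx,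
    dtlct_channel_add_pi a b d T hg₀ hh₀ hx, dtlct_channel_add_pi a b d T hg₁ hh₁ hx]
  ext i
  fin_cases i <;>
  · simp
    ring
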